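/- arXiv:2004.09553 — 2 statements merged into one kernel-verified Lean document; each statement's English description precedes it below -/
import Mathlib

section
/- For any commutative idempotent residuated chain A, the monoidal preorder ⊑ (defined by x ⊑ y ⟺ x·y = x) is a total order on A that is compatible with the lattice order ≤, i.e.: ⊑ is reflexive, antisymmetric, transitive, and total; 1 is the ⊑-greatest element; if A has a ≤-least element ⊥, then ⊥ is the ⊑-least element; for all x, y with 1 ≤ x and 1 ≤ y, x ≤ y ⟺ y ⊑ x; and for all x, y with x ≤ 1 and y ≤ 1, x ≤ y ⟺ x ⊑ y. -/
/-- Multiplication by a residuated element is monotone. -/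
theorem mul_le_mul_left_of_residuated {α : Type*} [Preorder α] [Mul α] {arrow : α → α → α}
    (resid : ∀ a b c : α, a * b ≤ c ↔ b ≤ arrow a c) (a : α) {b c : α} (h : b ≤ c) :
    a * b ≤ a * c :=
  (resid _ _ _).2 (h.trans ((resid _ _ _).1 le_rfl))

/-- In an idempotent commutative monoid with a total order and monotone multiplication, the
product of two elements is one of them. -/
theorem mul_eq_left_or_right_of_idempotent {α : Type*} [LinearOrder α] [CommMonoid α]
    (mono : ∀ a b c : α, b ≤ c → a * b ≤ a * c) (idem : ∀ a : α, a * a = a) (x y : α) :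
    x * y = x ∨ x * y = y := by
  wlog hxy : x ≤ y generalizing x y
  · rw [mul_comm x y]
    exact (this y x (le_of_not_ge hxy)).symm
  have lower : x ≤ x * y := by simpa [idem] using mono x x y hxy
  have upper : x * y ≤ y := by simpa [idem, mul_comm] using mono y x y hxy
  rcases le_total (x * y) 1 with h | h
  · left
    have hx := mono x _ _ h
    rw [← mul_assoc, idem, mul_one] at hx
    exact le_antisymm hx lower
  · right
    have hy := mono y _ _ h
    rw [mul_left_comm, idem, mul_one] at hy
    exact le_antisymm upper hy

/-- For a commutative idempotent residuated chain, the monoidal preorder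
`x ⊑ y ⟺ x * y = x` is a total order compatible with the lattice order. -/
theorem stmt_7 {α : Type*} [LinearOrder α] [CommMonoid α]
    (arrow : α → α → α)
    (resid : ∀ a b c : α, a * b ≤ c ↔ b ≤ arrow a c)
    (idem : ∀ a : α, a * a = a) :
    -- ⊑ is reflexive
    (∀ x : α, x * x = x) ∧
    -- ⊑ is antisymmetric
    (∀ x y : α, x * y = x → y * x = y → x = y) ∧
    -- ⊑ is transitive
    (∀ x y z : α, x * y = x → y * z = y → x * z = x) ∧
    -- ⊑ is total
    (∀ x y : α, x * y = x ∨ y * x = y) ∧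
    -- 1 is the ⊑-greatest element
    (∀ x : α, x * 1 = x) ∧
    -- a ≤-least element is the ⊑-least element
    (∀ bot : α, (∀ a : α, bot ≤ a) → ∀ x : α, bot * x = bot) ∧
    -- compatibility on the positive cone
    (∀ x y : α, 1 ≤ x → 1 ≤ y → (x ≤ y ↔ y * x = y)) ∧
    -- compatibility on the negative cone
    (∀ x y : α, x ≤ 1 → y ≤ 1 → (x ≤ y ↔ x * y = x)) := by
  have mono : ∀ a b c : α, b ≤ c → a * b ≤ a * c :=
    fun a _ _ h => mul_le_mul_left_of_residuated resid a h
  refine ⟨idem, fun x y hx hy => ?_, fun x y z hx hy => ?_, fun x y => ?_, mul_one,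
    fun bot hbot x => ?_, fun x y hx hy => ⟨fun h => ?_, fun h => ?_⟩,
    fun x y hx hy => ⟨fun h => ?_, fun h => ?_⟩⟩
  · rw [← hx, mul_comm, hy]
  · rw [← hx, mul_assoc, hy]
  · rw [mul_comm y x]
    exact mul_eq_left_or_right_of_idempotent mono idem x y
  · rw [mul_comm]
    exact le_antisymm ((resid _ _ _).2 (hbot _)) (hbot _)
  · exact le_antisymm (by simpa [idem] using mono y x y h) (by simpa using mono y 1 x hx)
  · rw [← h]
    simpa [mul_comm] using mono x 1 y hy
  · exact le_antisymm (by simpa using mono x y 1 hy) (by simpa [idem] using mono x x y h)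
  · rw [← h]
    simpa [mul_comm] using mono y x 1 hx
end

section
/- Let A be a commutative idempotent residuated chain and write ¬x := x→1. Then for all x, y ∈ A: if x ≤ y then x→y = ¬(¬¬x) ∨ y, and if y < x then x→y = ¬(¬¬x) ∧ y. (Equivalently, since ¬¬¬x = ¬x: x→y = ¬x ∨ y if x ≤ y, and x→y = ¬x ∧ y if y < x.) -/
section IdempotentResiduatedChain

variable {α : Type*} [LinearOrder α] [CommMonoid α] {arrow : α → α → α}

theorem mul_le_mul_left_of_resid (resid : ∀ a b c : α, a * b ≤ c ↔ b ≤ arrow a c)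
    (a : α) {b c : α} (h : b ≤ c) : a * b ≤ a * c :=
  (resid a b _).2 (h.trans ((resid a c _).1 le_rfl))

theorem mul_eq_min_of_mul_le_one (resid : ∀ a b c : α, a * b ≤ c ↔ b ≤ arrow a c)
    (idem : ∀ a : α, a * a = a) {a b : α} (h : a * b ≤ 1) : a * b = min a b := by
  have mono := fun a {b c : α} => mul_le_mul_left_of_resid resid a (b := b) (c := c)
  refine le_antisymm (le_min ?_ ?_) ?_
  · simpa [← mul_assoc, idem] using mono a h
  · simpa [mul_left_comm b a b, idem] using mono b h
  · calc min a b = min a b * min a b := (idem _).symm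
      _ ≤ min a b * b := mono _ (min_le_right a b)
      _ = b * min a b := mul_comm _ _
      _ ≤ b * a := mono _ (min_le_left a b)
      _ = a * b := mul_comm _ _

theorem mul_eq_max_of_one_le_mul (resid : ∀ a b c : α, a * b ≤ c ↔ b ≤ arrow a c)
    (idem : ∀ a : α, a * a = a) {a b : α} (h : 1 ≤ a * b) : a * b = max a b := by
  have mono := fun a {b c : α} => mul_le_mul_left_of_resid resid a (b := b) (c := c)
  refine le_antisymm ?_ (max_le ?_ ?_)
  · calc a * b ≤ a * max a b := mono _ (le_max_right a b)
      _ = max a b * a := mul_comm _ _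
      _ ≤ max a b * max a b := mono _ (le_max_left a b)
      _ = max a b := idem _
  · simpa [← mul_assoc, idem] using mono a h
  · simpa [mul_left_comm b a b, idem] using mono b h

theorem arrow_arrow_arrow_one (resid : ∀ a b c : α, a * b ≤ c ↔ b ≤ arrow a c) (x : α) :
    arrow (arrow (arrow x 1) 1) 1 = arrow x 1 := by
  have le_neg_neg : ∀ a : α, a ≤ arrow (arrow a 1) 1 := fun a => by
    rw [← resid, mul_comm, resid]
  refine le_antisymm ?_ (le_neg_neg _)
  rw [← resid, mul_comm]
  exact (mul_le_mul_left_of_resid resid _ (le_neg_neg x)).trans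
    (by rw [mul_comm, resid])

end IdempotentResiduatedChain

/-- For a commutative idempotent residuated chain, with `¬x := x → 1`:
if `x ≤ y` then `x → y = ¬(¬¬x) ⊔ y`, and if `y < x` then `x → y = ¬(¬¬x) ⊓ y`. -/
theorem stmt_11 {α : Type*} [LinearOrder α] [CommMonoid α]
    (arrow : α → α → α)
    (resid : ∀ a b c : α, a * b ≤ c ↔ b ≤ arrow a c)
    (idem : ∀ a : α, a * a = a) :
    ∀ x y : α,
      (x ≤ y → arrow x y = arrow (arrow (arrow x 1) 1) 1 ⊔ y) ∧
      (y < x → arrow x y = arrow (arrow (arrow x 1) 1) 1 ⊓ y) := by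
  intro x y
  rw [arrow_arrow_arrow_one resid]
  have mul_cases : ∀ z, (x * z ≤ 1 ∧ x * z = min x z) ∨ (¬ x * z ≤ 1 ∧ x * z = max x z) := by
    intro z
    by_cases h : x * z ≤ 1
    · exact Or.inl ⟨h, mul_eq_min_of_mul_le_one resid idem h⟩
    · exact Or.inr ⟨h, mul_eq_max_of_one_le_mul resid idem (not_le.1 h).le⟩
  constructor <;> intro hxy <;> refine eq_of_forall_le_iff fun z => ?_
  · rw [le_sup_iff, ← resid, ← resid]
    rcases mul_cases z with ⟨h, e⟩ | ⟨h, e⟩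
    · simp only [h, true_or, iff_true]
      exact e.trans_le ((min_le_left x z).trans hxy)
    · rw [e] at h ⊢
      simp only [h, false_or, max_le_iff, hxy, true_and]
  · rw [le_inf_iff, ← resid, ← resid]
    rcases mul_cases z with ⟨h, e⟩ | ⟨h, e⟩
    · rw [e] at h ⊢
      simp only [h, true_and, min_le_iff, hxy.not_ge, false_or]
    · rw [e] at h ⊢
      simp only [h, false_and, max_le_iff, hxy.not_ge]
end
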